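/- For every real s > 1, the improper integral ∫₀^∞ ψ(e^x) e^{−s x} dx converges and equals ∫₁^∞ v^{−s−1} ψ(v) dv = − ζ'(s) / ( s ζ(s) ), where ψ is the Chebyshev prime counting function and ζ the Riemann zeta function. -/

import Mathlib

open Filter Set MeasureTheory ArithmeticFunction

/-- The Chebyshev prime counting function `ψ(x) = ∑_{n ≤ x} Λ(n)`, where `Λ`
is the von Mangoldt function. -/
noncomputable def chebyshevPsi (x : ℝ) : ℝ := ∑ n ∈ Finset.Iic ⌊x⌋₊, Λ n

/-- The Riemann zeta function of a real variable, `ζ(s) = ∑_{n=1}^∞ 1/n^s`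
(the `n = 0` term vanishes since `(0 : ℝ)^s = 0` for `s ≠ 0`). -/
noncomputable def realZeta (s : ℝ) : ℝ := ∑' n : ℕ, 1 / (n : ℝ) ^ s

theorem chebyshevPsi_eq_psi : chebyshevPsi = Chebyshev.psi := by
  funext x
  rw [Chebyshev.psi_eq_sum_Icc, chebyshevPsi, ← Finset.Icc_bot, Nat.bot_eq_zero]

theorem ofReal_realZeta {s : ℝ} (hs : 1 < s) : (realZeta s : ℂ) = riemannZeta s := by
  rw [zeta_eq_tsum_one_div_nat_cpow (by simpa using hs), realZeta, Complex.ofReal_tsum]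
  refine tsum_congr fun n => ?_
  rw [Complex.ofReal_div, Complex.ofReal_one, Complex.ofReal_cpow n.cast_nonneg,
    Complex.ofReal_natCast]

theorem ofReal_deriv_realZeta {s : ℝ} (hs : 1 < s) :
    ((deriv realZeta s : ℝ) : ℂ) = deriv riemannZeta s := by
  have hζ : HasDerivAt riemannZeta (deriv riemannZeta s) (s : ℂ) :=
    (differentiableAt_riemannZeta (by exact_mod_cast hs.ne')).hasDerivAt
  have heq : realZeta =ᶠ[nhds s] fun t : ℝ => (riemannZeta t).re := by
    filter_upwards [lt_mem_nhds hs] with t ht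
    rw [← ofReal_realZeta ht, Complex.ofReal_re]
  have hreal := hζ.real_of_complex.congr_of_eventuallyEq heq
  refine hreal.differentiableAt.hasDerivAt.ofReal_comp.unique
    (hζ.comp_ofReal.congr_of_eventuallyEq ?_)
  filter_upwards [lt_mem_nhds hs] with t ht using ofReal_realZeta ht

theorem integrableOn_rpow_mul_chebyshevPsi {s : ℝ} (hs : 1 < s) :
    IntegrableOn (fun v : ℝ => v ^ (-s - 1) * chebyshevPsi v) (Ioi 1) := by
  rw [chebyshevPsi_eq_psi]
  have hdom : IntegrableOn (fun v : ℝ => (Real.log 4 + 4) * v ^ (-s)) (Ioi 1) :=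
    (integrableOn_Ioi_rpow_of_lt (by linarith) one_pos).const_mul _
  have hmeas : Measurable fun v : ℝ => v ^ (-s - 1) * Chebyshev.psi v :=
    (measurable_id.pow_const _).mul Chebyshev.psi_mono.measurable
  refine hdom.mono' hmeas.aestronglyMeasurable
    (ae_restrict_of_forall_mem measurableSet_Ioi fun v hv => ?_)
  have hv0 : 0 < v := one_pos.trans hv
  have hpow : v ^ (-s) = v ^ (-s - 1) * v := by
    rw [← Real.rpow_add_one hv0.ne', sub_add_cancel]
  rw [Real.norm_of_nonneg (mul_nonneg (by positivity) (Chebyshev.psi_nonneg v)), hpow]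
  calc v ^ (-s - 1) * Chebyshev.psi v
      ≤ v ^ (-s - 1) * ((Real.log 4 + 4) * v) := by
        gcongr
        exact Chebyshev.psi_le_const_mul_self hv0.le
    _ = _ := by ring

theorem LSeries_vonMangoldt_eq_mul_integral_chebyshevPsi {s : ℝ} (hs : 1 < s) :
    LSeries (fun n => (Λ n : ℂ)) s =
      ((s * ∫ v in Ioi (1 : ℝ), v ^ (-s - 1) * chebyshevPsi v : ℝ) : ℂ) := by
  have hsum (v : ℝ) : ∑ k ∈ Finset.Icc 1 ⌊v⌋₊, Λ k = Chebyshev.psi v := rfl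
  have hO : (fun n : ℕ => ∑ k ∈ Finset.Icc 1 n, Λ k) =O[atTop] fun n => (n : ℝ) ^ (1 : ℝ) := by
    refine Asymptotics.IsBigO.of_bound (Real.log 4 + 4) (Eventually.of_forall fun n => ?_)
    have h := hsum n
    rw [Nat.floor_natCast] at h
    rw [h, Real.rpow_one, Real.norm_of_nonneg (Chebyshev.psi_nonneg _),
      Real.norm_of_nonneg n.cast_nonneg]
    exact Chebyshev.psi_le_const_mul_self n.cast_nonneg
  rw [LSeries_eq_mul_integral_of_nonneg (fun n => Λ n) zero_le_one (by simpa using hs) hO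
    fun _ => vonMangoldt_nonneg, Complex.ofReal_mul, ← integral_complex_ofReal]
  congr 1
  refine setIntegral_congr_fun measurableSet_Ioi fun v hv => ?_
  have hv0 : (0 : ℝ) ≤ v := zero_le_one.trans (le_of_lt hv)
  simp only [chebyshevPsi_eq_psi, ← hsum v]
  push_cast [Complex.ofReal_cpow hv0]
  rw [mul_comm, neg_add']

/-- For every real `s > 1`, the improper integral `∫₀^∞ ψ(eˣ) e^{-sx} dx`
converges and equals `∫₁^∞ v^{-s-1} ψ(v) dv = −ζ'(s)/(s ζ(s))`. -/
theorem laplace_chebyshevPsi_eq (s : ℝ) (hs : 1 < s) :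
    IntegrableOn (fun x : ℝ => chebyshevPsi (Real.exp x) * Real.exp (-(s * x)))
      (Ioi 0) ∧
    (∫ x in Ioi (0 : ℝ), chebyshevPsi (Real.exp x) * Real.exp (-(s * x))) =
      ∫ v in Ioi (1 : ℝ), v ^ (-s - 1) * chebyshevPsi v ∧
    (∫ v in Ioi (1 : ℝ), v ^ (-s - 1) * chebyshevPsi v) =
      -(deriv realZeta s) / (s * realZeta s) := by
  have hsubst : (fun x : ℝ => chebyshevPsi (Real.exp x) * Real.exp (-(s * x))) =
      fun x => Real.exp x • (Real.exp x ^ (-s - 1) * chebyshevPsi (Real.exp x)) := by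
    funext x
    rw [smul_eq_mul, ← mul_assoc, ← Real.exp_mul, ← Real.exp_add, mul_comm]
    ring_nf
  refine ⟨?_, ?_, ?_⟩
  · rw [hsubst, integrableOn_comp_exp_Ioi (fun v => v ^ (-s - 1) * chebyshevPsi v), Real.exp_zero]
    exact integrableOn_rpow_mul_chebyshevPsi hs
  · rw [hsubst, integral_comp_exp_Ioi (fun v => v ^ (-s - 1) * chebyshevPsi v), Real.exp_zero]
  · have hL := LSeries_vonMangoldt_eq_mul_integral_chebyshevPsi hs
    rw [LSeries_vonMangoldt_eq_deriv_riemannZeta_div (by simpa using hs),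
      ← ofReal_realZeta hs, ← ofReal_deriv_realZeta hs] at hL
    have hreal : -deriv realZeta s / realZeta s =
        s * ∫ v in Ioi (1 : ℝ), v ^ (-s - 1) * chebyshevPsi v := by
      exact_mod_cast hL
    rw [mul_comm s, ← div_div, hreal, mul_div_cancel_left₀ _ (by linarith : s ≠ 0)]
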